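/- arXiv:1101.4841 — 7 statements merged into one kernel-verified Lean document; each statement's English description precedes it below -/
import Mathlib

section
/- For every t ∈ ℝ and r > 0, setting T = arctan(t+r) + arctan(t−r), R = arctan(t+r) − arctan(t−r) and Ω = cos T + cos R, one has −π < T < π, 0 < R < π, Ω > 0, and moreover sin T / Ω = t and sin R / Ω = r. -/
open Real

/-- For every `t ∈ ℝ` and `r > 0`, setting
`T = arctan (t+r) + arctan (t−r)`, `R = arctan (t+r) − arctan (t−r)` and
`Ω = cos T + cos R`, one has `−π < T < π`, `0 < R < π`, `Ω > 0`, and moreover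
`sin T / Ω = t` and `sin R / Ω = r`. -/
theorem penrose_transform_basic (t r T R Ω : ℝ) (hr : 0 < r)
    (hT : T = arctan (t + r) + arctan (t - r))
    (hR : R = arctan (t + r) - arctan (t - r))
    (hΩ : Ω = Real.cos T + Real.cos R) :
    -π < T ∧ T < π ∧ 0 < R ∧ R < π ∧ 0 < Ω ∧
      Real.sin T / Ω = t ∧ Real.sin R / Ω = r := by
  have sin_eq (x : ℝ) : sin (arctan x) = x * cos (arctan x) := by
    rw [← tan_mul_cos (cos_arctan_pos x).ne', tan_arctan]
  have hu := cos_arctan_pos (t + r)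
  have hv := cos_arctan_pos (t - r)
  have hΩ_eq : Ω = 2 * (cos (arctan (t + r)) * cos (arctan (t - r))) := by
    rw [hΩ, hT, hR, cos_add, cos_sub]
    ring
  have hΩ_pos : 0 < Ω := by
    rw [hΩ_eq]
    positivity
  have hlt : arctan (t - r) < arctan (t + r) := arctan_strictMono (by linarith)
  have hu_lower := neg_pi_div_two_lt_arctan (t + r)
  have hu_upper := arctan_lt_pi_div_two (t + r)
  have hv_lower := neg_pi_div_two_lt_arctan (t - r)
  have hv_upper := arctan_lt_pi_div_two (t - r)
  refine ⟨by linarith, by linarith, by linarith, by linarith, hΩ_pos, ?_, ?_⟩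
  · rw [div_eq_iff hΩ_pos.ne', hΩ_eq, hT, sin_add, sin_eq, sin_eq]
    ring
  · rw [div_eq_iff hΩ_pos.ne', hΩ_eq, hR, sin_sub, sin_eq, sin_eq]
    ring
end

section
/- Let D = {(T,R) ∈ ℝ² : −π < T < π, 0 < R < π, cos T + cos R > 0} and let Φ : D → ℝ² be the map Φ(T,R) = (sin T / (cos T + cos R), sin R / (cos T + cos R)). Then at every point (T,R) ∈ D the map Φ is differentiable and the determinant of its derivative equals 1/(cos T + cos R)², i.e. the Jacobian determinant of the inverse Penrose transform is Ω^{−2} where Ω = cos T + cos R. -/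
open Real

/-- The determinant of an endomorphism of `ℝ × ℝ` in terms of the images of the standard basis. -/
theorem det_continuousLinearMap_prod (L : ℝ × ℝ →L[ℝ] ℝ × ℝ) :
    L.det = (L (1, 0)).1 * (L (0, 1)).2 - (L (0, 1)).1 * (L (1, 0)).2 := by
  rw [ContinuousLinearMap.det, ← LinearMap.det_toMatrix (Module.Basis.finTwoProd ℝ),
    Matrix.det_fin_two]
  simp [LinearMap.toMatrix_apply]

/-- Let `D = {(T,R) : −π < T < π, 0 < R < π, cos T + cos R > 0}` and
`Φ(T,R) = (sin T / (cos T + cos R), sin R / (cos T + cos R))`. Then at every point of `D`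
the map `Φ` is differentiable and the determinant of its derivative equals
`1/(cos T + cos R)²`, i.e. the Jacobian determinant of the inverse Penrose transform is
`Ω⁻²` where `Ω = cos T + cos R`. -/
theorem penrose_inverse_jacobian (D : Set (ℝ × ℝ))
    (hD : D = {q : ℝ × ℝ |
      -π < q.1 ∧ q.1 < π ∧ 0 < q.2 ∧ q.2 < π ∧ 0 < Real.cos q.1 + Real.cos q.2})
    (Φ : ℝ × ℝ → ℝ × ℝ)
    (hΦ : ∀ q : ℝ × ℝ, Φ q =
      (Real.sin q.1 / (Real.cos q.1 + Real.cos q.2),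
       Real.sin q.2 / (Real.cos q.1 + Real.cos q.2))) :
    ∀ q ∈ D, DifferentiableAt ℝ Φ q ∧
      (fderiv ℝ Φ q).det = 1 / (Real.cos q.1 + Real.cos q.2) ^ 2 := by
  intro q hq
  rw [hD] at hq
  obtain ⟨-, -, -, -, hΩ⟩ := hq
  have hΩ' := hΩ.ne'
  have hT : HasFDerivAt (fun p : ℝ × ℝ => p.1) (ContinuousLinearMap.fst ℝ ℝ ℝ) q := hasFDerivAt_fst
  have hR : HasFDerivAt (fun p : ℝ × ℝ => p.2) (ContinuousLinearMap.snd ℝ ℝ ℝ) q := hasFDerivAt_snd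
  have hΩd := hT.cos.add hR.cos
  have hInv := (hasDerivAt_inv hΩ').comp_hasFDerivAt q hΩd
  have h := (hT.sin.mul hInv).prodMk (hR.sin.mul hInv)
  have hΦd := h.congr_of_eventuallyEq (f₁ := Φ) (Filter.Eventually.of_forall fun p => by
    simp [hΦ, div_eq_mul_inv])
  refine ⟨hΦd.differentiableAt, ?_⟩
  rw [hΦd.fderiv, det_continuousLinearMap_prod]
  simp
  field_simp
  have hsT := Real.sin_sq_add_cos_sq q.1
  have hsR := Real.sin_sq_add_cos_sq q.2
  grind
end

section
/- Let D = {(T,R) ∈ ℝ² : −π < T < π, 0 < R < π, cos T + cos R > 0} and Ω(T,R) = cos T + cos R. Let p ∈ [1,∞) and let φ : D → ℝ be measurable. Define ψ : ℝ × (0,∞) → ℝ by ψ(t,r) = Ω(T,R) · φ(T,R), where T = arctan(t+r) + arctan(t−r) and R = arctan(t+r) − arctan(t−r). Then ∫_ℝ ∫₀^∞ |ψ(t,r)|^p r² dr dt = ∫∫_D Ω(T,R)^{p−4} |φ(T,R)|^p sin² R dR dT (as an equality in [0,∞]). -/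
open Real MeasureTheory

/-- Passing from `(t, r)` to the Penrose coordinates `(T, R)`. -/
noncomputable def penroseMap (q : ℝ × ℝ) : ℝ × ℝ :=
  (arctan (q.1 + q.2) + arctan (q.1 - q.2), arctan (q.1 + q.2) - arctan (q.1 - q.2))

/-- The derivative of `penroseMap`. -/
noncomputable def fderivPenroseMap (q : ℝ × ℝ) : ℝ × ℝ →L[ℝ] ℝ × ℝ :=
  LinearMap.toContinuousLinearMap (Matrix.toLin (Module.Basis.finTwoProd ℝ)
    (Module.Basis.finTwoProd ℝ)
    !![1 / (1 + (q.1 + q.2) ^ 2) + 1 / (1 + (q.1 - q.2) ^ 2),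
        1 / (1 + (q.1 + q.2) ^ 2) - 1 / (1 + (q.1 - q.2) ^ 2);
      1 / (1 + (q.1 + q.2) ^ 2) - 1 / (1 + (q.1 - q.2) ^ 2),
        1 / (1 + (q.1 + q.2) ^ 2) + 1 / (1 + (q.1 - q.2) ^ 2)])

theorem hasFDerivAt_penroseMap (q : ℝ × ℝ) :
    HasFDerivAt penroseMap (fderivPenroseMap q) q := by
  unfold fderivPenroseMap penroseMap
  rw [Matrix.toLin_finTwoProd_toContinuousLinearMap]
  have hadd : HasFDerivAt (fun q : ℝ × ℝ => arctan (q.1 + q.2)) _ q :=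
    (hasFDerivAt_fst.add hasFDerivAt_snd).arctan
  have hsub : HasFDerivAt (fun q : ℝ × ℝ => arctan (q.1 - q.2)) _ q :=
    (hasFDerivAt_fst.sub hasFDerivAt_snd).arctan
  convert (hadd.add hsub).prodMk (hadd.sub hsub) using 2 <;>
  · ext <;> simp [sub_eq_add_neg]

theorem cos_penroseMap_add (q : ℝ × ℝ) :
    cos (penroseMap q).1 + cos (penroseMap q).2 =
      2 * (cos (arctan (q.1 + q.2)) * cos (arctan (q.1 - q.2))) := by
  simp only [penroseMap, cos_add, cos_sub]
  ring

theorem cos_penroseMap_add_pos (q : ℝ × ℝ) :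
    0 < cos (penroseMap q).1 + cos (penroseMap q).2 := by
  rw [cos_penroseMap_add]
  have := cos_arctan_pos (q.1 + q.2)
  have := cos_arctan_pos (q.1 - q.2)
  positivity

theorem det_fderivPenroseMap (q : ℝ × ℝ) :
    (fderivPenroseMap q).det = (cos (penroseMap q).1 + cos (penroseMap q).2) ^ 2 := by
  rw [cos_penroseMap_add, mul_pow, mul_pow, cos_sq_arctan, cos_sq_arctan]
  simp only [fderivPenroseMap, LinearMap.det_toContinuousLinearMap, LinearMap.det_toLin,
    Matrix.det_fin_two_of]
  ring

theorem sin_penroseMap_snd (q : ℝ × ℝ) :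
    sin (penroseMap q).2 = q.2 * (cos (penroseMap q).1 + cos (penroseMap q).2) := by
  have sin_arctan_eq (x : ℝ) : sin (arctan x) = x * cos (arctan x) := by
    rw [← tan_mul_cos (cos_arctan_pos x).ne', tan_arctan]
  rw [cos_penroseMap_add]
  simp only [penroseMap, sin_sub, sin_arctan_eq]
  ring

theorem injective_penroseMap : Function.Injective penroseMap := by
  intro a b h
  simp only [penroseMap, Prod.mk.injEq] at h
  have hadd : a.1 + a.2 = b.1 + b.2 := arctan_injective (by linarith [h.1, h.2])
  have hsub : a.1 - a.2 = b.1 - b.2 := arctan_injective (by linarith [h.1, h.2])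
  exact Prod.ext (by linarith) (by linarith)

theorem penroseMap_image :
    penroseMap '' (Set.univ ×ˢ Set.Ioi 0) = {q : ℝ × ℝ |
      -π < q.1 ∧ q.1 < π ∧ 0 < q.2 ∧ q.2 < π ∧ 0 < cos q.1 + cos q.2} := by
  ext ⟨T, R⟩
  constructor
  · rintro ⟨q, hq, h⟩
    have hr : 0 < q.2 := hq.2
    have hlt : arctan (q.1 - q.2) < arctan (q.1 + q.2) := arctan_strictMono (by linarith)
    have hpos := cos_penroseMap_add_pos q
    rw [← h]
    have h1 := arctan_lt_pi_div_two (q.1 + q.2)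
    have h2 := neg_pi_div_two_lt_arctan (q.1 + q.2)
    have h3 := arctan_lt_pi_div_two (q.1 - q.2)
    have h4 := neg_pi_div_two_lt_arctan (q.1 - q.2)
    refine ⟨?_, ?_, ?_, ?_, hpos⟩ <;> simp only [penroseMap] <;> linarith
  · rintro ⟨hT, hT', hR, hR', hpos⟩
    dsimp only at hT hT' hR hR' hpos
    obtain ⟨x, hx⟩ : ∃ x, x = (T + R) / 2 := ⟨_, rfl⟩
    obtain ⟨y, hy⟩ : ∃ y, y = (T - R) / 2 := ⟨_, rfl⟩
    obtain rfl : T = x + y := by linarith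
    obtain rfl : R = x - y := by linarith
    have hcos : 0 < cos x * cos y := by
      rw [cos_add, cos_sub] at hpos
      linarith
    have hxlt : x < π / 2 := by
      by_contra! hle
      have hcx : cos x ≤ 0 := cos_nonpos_of_pi_div_two_le_of_le hle (by linarith)
      have hcy : 0 ≤ cos y := cos_nonneg_of_mem_Icc ⟨by linarith, by linarith⟩
      exact hcos.not_ge (mul_nonpos_of_nonpos_of_nonneg hcx hcy)
    have hylt : -(π / 2) < y := by
      by_contra! hle
      have hcy : cos y ≤ 0 := by
        rw [← cos_neg]
        exact cos_nonpos_of_pi_div_two_le_of_le (by linarith) (by linarith)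
      have hcx : 0 ≤ cos x := cos_nonneg_of_mem_Icc ⟨by linarith, by linarith⟩
      exact hcos.not_ge (mul_nonpos_of_nonneg_of_nonpos hcx hcy)
    have htan : tan y < tan x := strictMonoOn_tan ⟨by linarith, by linarith⟩
      ⟨by linarith, by linarith⟩ (by linarith)
    refine ⟨((tan x + tan y) / 2, (tan x - tan y) / 2), ⟨trivial, ?_⟩, ?_⟩
    · exact div_pos (sub_pos.2 htan) two_pos
    · have hadd : (tan x + tan y) / 2 + (tan x - tan y) / 2 = tan x := by ring
      have hsub : (tan x + tan y) / 2 - (tan x - tan y) / 2 = tan y := by ring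
      simp only [penroseMap, hadd, hsub]
      rw [arctan_tan (by linarith) (by linarith), arctan_tan (by linarith) (by linarith)]

/-- Change of variables for the Penrose transform: for `p ∈ [1,∞)` and a
measurable `φ` on `D = {(T,R) : −π < T < π, 0 < R < π, Ω := cos T + cos R > 0}`, setting
`ψ(t,r) = Ω(T,R) φ(T,R)` with `T = arctan (t+r) + arctan (t−r)`,
`R = arctan (t+r) − arctan (t−r)`, one has
`∫_ℝ ∫₀^∞ |ψ(t,r)|^p r² dr dt = ∫∫_D Ω^{p−4} |φ|^p sin² R dR dT` in `[0,∞]`. -/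
theorem penrose_lp_change_of_variables (p : ℝ) (hp : 1 ≤ p)
    (D : Set (ℝ × ℝ))
    (hD : D = {q : ℝ × ℝ |
      -π < q.1 ∧ q.1 < π ∧ 0 < q.2 ∧ q.2 < π ∧ 0 < Real.cos q.1 + Real.cos q.2})
    (φ : ℝ × ℝ → ℝ) (hφ : Measurable φ)
    (ψ : ℝ × ℝ → ℝ)
    (hψ : ∀ t r : ℝ, ψ (t, r) =
      (Real.cos (arctan (t + r) + arctan (t - r)) +
        Real.cos (arctan (t + r) - arctan (t - r))) *
      φ (arctan (t + r) + arctan (t - r), arctan (t + r) - arctan (t - r))) :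
    ∫⁻ t : ℝ, ∫⁻ r in Set.Ioi (0 : ℝ), ENNReal.ofReal (|ψ (t, r)| ^ p * r ^ 2)
      = ∫⁻ q in D, ENNReal.ofReal
          ((Real.cos q.1 + Real.cos q.2) ^ (p - 4) * |φ q| ^ p * Real.sin q.2 ^ 2) := by
  have hψ' (q : ℝ × ℝ) :
      ψ q = (cos (penroseMap q).1 + cos (penroseMap q).2) * φ (penroseMap q) := hψ q.1 q.2
  have hmap : Measurable penroseMap :=
    (continuous_iff_continuousAt.2 fun q => (hasFDerivAt_penroseMap q).continuousAt).measurable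
  have hψm : Measurable ψ := by
    rw [funext hψ']
    exact ((measurable_cos.comp hmap.fst).add (measurable_cos.comp hmap.snd)).mul (hφ.comp hmap)
  have hs : MeasurableSet (Set.univ ×ˢ Set.Ioi 0 : Set (ℝ × ℝ)) :=
    MeasurableSet.univ.prod measurableSet_Ioi
  rw [hD, ← penroseMap_image, lintegral_image_eq_lintegral_abs_det_fderiv_mul volume hs
    (fun q _ => (hasFDerivAt_penroseMap q).hasFDerivWithinAt) injective_penroseMap.injOn]
  calc
    _ = ∫⁻ q in Set.univ ×ˢ Set.Ioi (0 : ℝ), ENNReal.ofReal (|ψ q| ^ p * q.2 ^ 2) := by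
      rw [Measure.volume_eq_prod, ← Measure.prod_restrict, Measure.restrict_univ,
        lintegral_prod]
      exact (by fun_prop : Measurable fun q : ℝ × ℝ =>
        ENNReal.ofReal (|ψ q| ^ p * q.2 ^ 2)).aemeasurable
    _ = _ := by
      refine lintegral_congr fun q => ?_
      rw [← ENNReal.ofReal_mul (abs_nonneg _), det_fderivPenroseMap, abs_sq,
        sin_penroseMap_snd, hψ' q]
      have hpos := cos_penroseMap_add_pos q
      rw [abs_mul, abs_of_pos hpos, mul_rpow hpos.le (abs_nonneg _)]
      generalize cos (penroseMap q).1 + cos (penroseMap q).2 = w at hpos ⊢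
      have hw : w ^ p = w ^ (p - 4) * w ^ 4 := by
        rw [← rpow_natCast w 4, ← rpow_add hpos]
        norm_num
      rw [hw]
      congr 1
      ring
end

section
/- Let f : ℝ × (0,∞) → ℝ be twice continuously differentiable, let D = {(T,R) : −π < T < π, 0 < R < π, Ω(T,R) := cos T + cos R > 0}, and define v : D → ℝ by v(T,R) = f(sin T/Ω, sin R/Ω)/Ω. Then v is twice continuously differentiable on D and at every (T,R) ∈ D, writing t = sin T/Ω and r = sin R/Ω, one has Ω³ · ( ∂²_T v − ∂²_R v − (2 cos R/sin R) ∂_R v + v )(T,R) = ( ∂²_t f − ∂²_r f − (2/r) ∂_r f )(t,r); that is, the Penrose transform turns the radial d'Alembertian on ℝ × ℝ³ into the d'Alembertian on (−π,π) × S³. -/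
open Real

open Topology

/-- A function `f` of two variables with partial derivatives `p` and `q` on `U`, in the form of the
chain rule along curves. -/
def HasPartialsOn (f p q : ℝ × ℝ → ℝ) (U : Set (ℝ × ℝ)) : Prop :=
  ∀ (a b : ℝ → ℝ) (a' b' s : ℝ), HasDerivAt a a' s → HasDerivAt b b' s → (a s, b s) ∈ U →
    HasDerivAt (fun x => f (a x, b x)) (p (a s, b s) * a' + q (a s, b s) * b') s

theorem hasPartialsOn_fderiv {f : ℝ × ℝ → ℝ} {U : Set (ℝ × ℝ)}
    (hf : ∀ z ∈ U, DifferentiableAt ℝ f z) :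
    HasPartialsOn f (fun z => fderiv ℝ f z (1, 0)) (fun z => fderiv ℝ f z (0, 1)) U := by
  intro a b a' b' s ha hb hs
  have h := (hf _ hs).hasFDerivAt.comp_hasDerivAt s (ha.prodMk hb)
  refine h.congr_deriv ?_
  have hab : ((a', b') : ℝ × ℝ) = a' • (1, 0) + b' • (0, 1) := by simp
  rw [hab, map_add, map_smul, map_smul]
  simp only [smul_eq_mul]
  ring

theorem exists_hasPartialsOn_of_contDiffOn_two {f : ℝ × ℝ → ℝ} {U : Set (ℝ × ℝ)} (hU : IsOpen U)
    (hf : ContDiffOn ℝ 2 f U) :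
    ∃ p q pp pq qq : ℝ × ℝ → ℝ,
      HasPartialsOn f p q U ∧ HasPartialsOn p pp pq U ∧ HasPartialsOn q pq qq U := by
  have hat : ∀ z ∈ U, ContDiffAt ℝ 2 f z := fun z hz => hf.contDiffAt (hU.mem_nhds hz)
  have hd : ∀ z ∈ U, DifferentiableAt ℝ (fderiv ℝ f) z := fun z hz =>
    ((hat z hz).fderiv_right (m := 1) (by norm_num)).differentiableAt (by norm_num)
  have hd' : ∀ (e : ℝ × ℝ), ∀ z ∈ U, DifferentiableAt ℝ (fun z => fderiv ℝ f z e) z :=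
    fun e z hz => (hd z hz).clm_apply (differentiableAt_const e)
  have hval : ∀ (e e' : ℝ × ℝ), ∀ z ∈ U,
      fderiv ℝ (fun z => fderiv ℝ f z e) z e' = fderiv ℝ (fderiv ℝ f) z e' e := by
    intro e e' z hz
    rw [fderiv_clm_apply (hd z hz) (differentiableAt_const e)]
    simp
  refine ⟨_, _, _, _, fun z => fderiv ℝ (fun z => fderiv ℝ f z (0, 1)) z (0, 1), hasPartialsOn_fderiv fun z hz => (hat z hz).differentiableAt (by norm_num),
    hasPartialsOn_fderiv (hd' (1, 0)), ?_⟩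
  intro a b a' b' s ha hb hs
  refine (hasPartialsOn_fderiv (hd' (0, 1)) a b a' b' s ha hb hs).congr_deriv ?_
  congr 2
  beta_reduce
  rw [hval _ _ _ hs, hval _ _ _ hs]
  exact ((hat _ hs).isSymmSndFDerivAt (by simp)).eq _ _

/-- First and second derivatives of `f (a x, b x) * g x` along a curve `(a, b)`. -/
theorem deriv_weighted_comp {f p q pp pq qq : ℝ × ℝ → ℝ} {U : Set (ℝ × ℝ)}
    (hf : HasPartialsOn f p q U) (hp : HasPartialsOn p pp pq U) (hq : HasPartialsOn q pq qq U)
    {a b g a₁ b₁ g₁ : ℝ → ℝ} {a₂ b₂ g₂ s : ℝ} {V : Set ℝ} (hV : IsOpen V) (hs : s ∈ V)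
    (ha : ∀ x ∈ V, HasDerivAt a (a₁ x) x) (hb : ∀ x ∈ V, HasDerivAt b (b₁ x) x)
    (hg : ∀ x ∈ V, HasDerivAt g (g₁ x) x) (hU : ∀ x ∈ V, (a x, b x) ∈ U)
    (ha₂ : HasDerivAt a₁ a₂ s) (hb₂ : HasDerivAt b₁ b₂ s) (hg₂ : HasDerivAt g₁ g₂ s) :
    deriv (fun x => f (a x, b x) * g x) s =
        (p (a s, b s) * a₁ s + q (a s, b s) * b₁ s) * g s + f (a s, b s) * g₁ s ∧
      deriv (fun y => deriv (fun x => f (a x, b x) * g x) y) s =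
        (pp (a s, b s) * a₁ s ^ 2 + 2 * pq (a s, b s) * a₁ s * b₁ s + qq (a s, b s) * b₁ s ^ 2
            + p (a s, b s) * a₂ + q (a s, b s) * b₂) * g s
          + 2 * (p (a s, b s) * a₁ s + q (a s, b s) * b₁ s) * g₁ s + f (a s, b s) * g₂ := by
  have h₁ : ∀ x ∈ V, HasDerivAt (fun x => f (a x, b x) * g x)
      ((p (a x, b x) * a₁ x + q (a x, b x) * b₁ x) * g x + f (a x, b x) * g₁ x) x :=
    fun x hx => (hf a b _ _ x (ha x hx) (hb x hx) (hU x hx)).mul (hg x hx)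
  refine ⟨(h₁ s hs).deriv, ?_⟩
  have heq : (fun y => deriv (fun x => f (a x, b x) * g x) y) =ᶠ[𝓝 s]
      fun x => (p (a x, b x) * a₁ x + q (a x, b x) * b₁ x) * g x + f (a x, b x) * g₁ x :=
    Filter.eventually_of_mem (hV.mem_nhds hs) fun x hx => (h₁ x hx).deriv
  rw [heq.deriv_eq]
  have hF := hf a b _ _ s (ha s hs) (hb s hs) (hU s hs)
  have hP := hp a b _ _ s (ha s hs) (hb s hs) (hU s hs)
  have hQ := hq a b _ _ s (ha s hs) (hb s hs) (hU s hs)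
  refine HasDerivAt.deriv (((((hP.mul ha₂).add (hQ.mul hb₂)).mul (hg s hs)).add
    (hF.mul hg₂)).congr_deriv ?_)
  simp only [Pi.mul_apply, Pi.add_apply]
  ring

theorem hasDerivAt_cos_add (x y : ℝ) : HasDerivAt (fun x => cos x + cos y) (-sin x) x :=
  (hasDerivAt_cos x).add_const _

theorem hasDerivAt_inv_cos_add {x y : ℝ} (h : cos x + cos y ≠ 0) :
    HasDerivAt (fun x => (cos x + cos y)⁻¹) (sin x / (cos x + cos y) ^ 2) x := by
  refine HasDerivAt.congr_deriv ((hasDerivAt_cos_add x y).inv h) ?_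
  simp

theorem hasDerivAt_sin_div_cos_add {x y : ℝ} (h : cos x + cos y ≠ 0) :
    HasDerivAt (fun x => sin x / (cos x + cos y))
      ((1 + cos x * cos y) / (cos x + cos y) ^ 2) x := by
  refine ((hasDerivAt_sin x).div (hasDerivAt_cos_add x y) h).congr_deriv ?_
  congr 1
  linear_combination sin_sq_add_cos_sq x

theorem hasDerivAt_const_div_cos_add (c : ℝ) {x y : ℝ} (h : cos x + cos y ≠ 0) :
    HasDerivAt (fun x => c / (cos x + cos y)) (c * sin x / (cos x + cos y) ^ 2) x := by
  refine ((hasDerivAt_const x c).div (hasDerivAt_cos_add x y) h).congr_deriv ?_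
  congr 1
  ring

theorem hasDerivAt_const_mul_sin_div_cos_add_sq (c : ℝ) {x y : ℝ} (h : cos x + cos y ≠ 0) :
    HasDerivAt (fun x => c * sin x / (cos x + cos y) ^ 2)
      (c * (cos x * (cos x + cos y) + 2 * sin x ^ 2) / (cos x + cos y) ^ 3) x := by
  refine (((hasDerivAt_sin x).const_mul c).div ((hasDerivAt_cos_add x y).pow 2)
    (pow_ne_zero 2 h)).congr_deriv ?_
  simp only [Pi.pow_apply]
  field_simp
  ring

theorem hasDerivAt_one_add_cos_mul_div_cos_add_sq {x y : ℝ} (h : cos x + cos y ≠ 0) :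
    HasDerivAt (fun x => (1 + cos x * cos y) / (cos x + cos y) ^ 2)
      (sin x * (2 + cos x * cos y - cos y ^ 2) / (cos x + cos y) ^ 3) x := by
  refine ((((hasDerivAt_cos x).mul_const (cos y)).const_add 1).div
    ((hasDerivAt_cos_add x y).pow 2) (pow_ne_zero 2 h)).congr_deriv ?_
  simp only [Pi.pow_apply]
  field_simp
  ring

/-- The Penrose transform turns the radial d'Alembertian on `ℝ × ℝ³`
into the d'Alembertian on `(−π,π) × S³`: if `f` is `C²` on `ℝ × (0,∞)` and
`v(T,R) = f(sin T/Ω, sin R/Ω)/Ω` on `D = {Ω := cos T + cos R > 0, −π < T < π, 0 < R < π}`,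
then `v` is `C²` on `D` and, with `t = sin T/Ω`, `r = sin R/Ω`,
`Ω³ (∂²_T v − ∂²_R v − (2 cos R/sin R) ∂_R v + v) = ∂²_t f − ∂²_r f − (2/r) ∂_r f`. -/
theorem penrose_transforms_dalembertian (f : ℝ × ℝ → ℝ)
    (hf : ContDiffOn ℝ 2 f (Set.univ ×ˢ Set.Ioi (0 : ℝ)))
    (D : Set (ℝ × ℝ))
    (hD : D = {q : ℝ × ℝ |
      -π < q.1 ∧ q.1 < π ∧ 0 < q.2 ∧ q.2 < π ∧ 0 < Real.cos q.1 + Real.cos q.2})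
    (v : ℝ × ℝ → ℝ)
    (hv : ∀ T R : ℝ, v (T, R) =
      f (Real.sin T / (Real.cos T + Real.cos R),
         Real.sin R / (Real.cos T + Real.cos R)) / (Real.cos T + Real.cos R)) :
    ContDiffOn ℝ 2 v D ∧
    ∀ T R t r : ℝ, (T, R) ∈ D →
      t = Real.sin T / (Real.cos T + Real.cos R) →
      r = Real.sin R / (Real.cos T + Real.cos R) →
      (Real.cos T + Real.cos R) ^ 3 *
        (deriv (fun T' => deriv (fun T'' => v (T'', R)) T') T
          - deriv (fun R' => deriv (fun R'' => v (T, R'')) R') R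
          - (2 * Real.cos R / Real.sin R) * deriv (fun R' => v (T, R')) R
          + v (T, R))
      = deriv (fun t' => deriv (fun t'' => f (t'', r)) t') t
          - deriv (fun r' => deriv (fun r'' => f (t, r'')) r') r
          - (2 / r) * deriv (fun r' => f (t, r')) r := by
  have hU : IsOpen (Set.univ ×ˢ Set.Ioi (0 : ℝ) : Set (ℝ × ℝ)) := isOpen_univ.prod isOpen_Ioi
  have hmem : ∀ T R, (T, R) ∈ D → 0 < sin R ∧ 0 < cos T + cos R := by
    intro T R h
    subst hD
    exact ⟨sin_pos_of_pos_of_lt_pi h.2.2.1 h.2.2.2.1, h.2.2.2.2⟩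
  constructor
  · have hv' : v = fun z => f (sin z.1 / (cos z.1 + cos z.2), sin z.2 / (cos z.1 + cos z.2)) /
        (cos z.1 + cos z.2) := funext fun z => hv z.1 z.2
    have hΩ : ContDiffOn ℝ 2 (fun z : ℝ × ℝ => cos z.1 + cos z.2) D := by fun_prop
    have hne : ∀ z ∈ D, cos z.1 + cos z.2 ≠ 0 := fun z hz => (hmem z.1 z.2 hz).2.ne'
    have hs₁ : ContDiffOn ℝ 2 (fun z : ℝ × ℝ => sin z.1) D := by fun_prop
    have hs₂ : ContDiffOn ℝ 2 (fun z : ℝ × ℝ => sin z.2) D := by fun_prop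
    rw [hv']
    exact (hf.comp ((hs₁.div hΩ hne).prodMk (hs₂.div hΩ hne)) fun z hz =>
      ⟨Set.mem_univ _, div_pos (hmem z.1 z.2 hz).1 (hmem z.1 z.2 hz).2⟩).div hΩ hne
  · intro T R t r hTR ht hr
    obtain ⟨hsin, hΩ⟩ := hmem T R hTR
    have hΩ' : 0 < cos R + cos T := by rwa [add_comm]
    obtain ⟨p, q, pp, pq, qq, hfp, hp, hq⟩ := exists_hasPartialsOn_of_contDiffOn_two hU hf
    have hrpos : 0 < r := hr ▸ div_pos hsin hΩ
    have hVT : IsOpen {x | 0 < cos x + cos R} := isOpen_lt continuous_const (by fun_prop)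
    have hVR : IsOpen {x | 0 < sin x ∧ 0 < cos x + cos T} :=
      (isOpen_lt continuous_const continuous_sin).inter
        (isOpen_lt continuous_const (continuous_cos.add continuous_const))
    have hvT : (fun x => v (x, R)) = fun x =>
        f (sin x / (cos x + cos R), sin R / (cos x + cos R)) * (cos x + cos R)⁻¹ :=
      funext fun x => by rw [hv, div_eq_mul_inv (f _)]
    have hvR : (fun x => v (T, x)) = fun x =>
        f (sin T / (cos x + cos T), sin x / (cos x + cos T)) * (cos x + cos T)⁻¹ :=
      funext fun x => by rw [hv, div_eq_mul_inv (f _), add_comm (cos T)]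
    have hinv : ∀ {x y : ℝ}, cos x + cos y ≠ 0 →
        HasDerivAt (fun x => sin x / (cos x + cos y) ^ 2)
          ((cos x * (cos x + cos y) + 2 * sin x ^ 2) / (cos x + cos y) ^ 3) x := fun h => by
      simpa using hasDerivAt_const_mul_sin_div_cos_add_sq 1 h
    obtain ⟨-, dT⟩ := deriv_weighted_comp hfp hp hq hVT hΩ
      (fun x hx => hasDerivAt_sin_div_cos_add (ne_of_gt hx))
      (fun x hx => hasDerivAt_const_div_cos_add (sin R) (ne_of_gt hx))
      (fun x hx => hasDerivAt_inv_cos_add (ne_of_gt hx))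
      (fun x hx => ⟨Set.mem_univ _, div_pos hsin hx⟩)
      (hasDerivAt_one_add_cos_mul_div_cos_add_sq hΩ.ne')
      (hasDerivAt_const_mul_sin_div_cos_add_sq (sin R) hΩ.ne') (hinv hΩ.ne')
    obtain ⟨dR₁, dR⟩ := deriv_weighted_comp hfp hp hq hVR ⟨hsin, hΩ'⟩
      (fun x hx => hasDerivAt_const_div_cos_add (sin T) (ne_of_gt hx.2))
      (fun x hx => hasDerivAt_sin_div_cos_add (ne_of_gt hx.2))
      (fun x hx => hasDerivAt_inv_cos_add (ne_of_gt hx.2))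
      (fun x hx => ⟨Set.mem_univ _, div_pos hx.1 hx.2⟩)
      (hasDerivAt_const_mul_sin_div_cos_add_sq (sin T) hΩ'.ne')
      (hasDerivAt_one_add_cos_mul_div_cos_add_sq hΩ'.ne') (hinv hΩ'.ne')
    obtain ⟨-, dt⟩ := deriv_weighted_comp (s := t) hfp hp hq isOpen_univ (Set.mem_univ _)
      (fun x _ => hasDerivAt_id' x) (fun x _ => hasDerivAt_const x r)
      (fun x _ => hasDerivAt_const x (1 : ℝ)) (fun x _ => ⟨Set.mem_univ _, hrpos⟩)
      (hasDerivAt_const t _) (hasDerivAt_const t _) (hasDerivAt_const t _)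
    obtain ⟨dr₁, dr⟩ := deriv_weighted_comp (s := r) hfp hp hq isOpen_Ioi hrpos
      (fun x _ => hasDerivAt_const x t) (fun x _ => hasDerivAt_id' x)
      (fun x _ => hasDerivAt_const x (1 : ℝ)) (fun x hx => ⟨Set.mem_univ _, hx⟩)
      (hasDerivAt_const r _) (hasDerivAt_const r _) (hasDerivAt_const r _)
    simp only [mul_one, mul_zero, add_zero, zero_add, one_pow, ne_eq, OfNat.ofNat_ne_zero,
      not_false_eq_true, zero_pow] at dt dr dr₁
    rw [add_comm (cos R), ← ht, ← hr] at dR₁ dR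
    rw [← ht, ← hr] at dT
    rw [hvT, hvR, dT, dR, dR₁, dt, dr, dr₁, hv, ← ht, ← hr]
    generalize pp (t, r) = A, pq (t, r) = B, qq (t, r) = C, p (t, r) = P, q (t, r) = Q,
      f (t, r) = F
    subst hr
    have hT := sin_sq_add_cos_sq T
    have hR := sin_sq_add_cos_sq R
    have hΩ₀ := hΩ.ne'
    have hsin₀ := hsin.ne'
    rw [mul_comm (cos R) (cos T)]
    generalize cos T = c, cos R = k, sin T = s, sin R = σ at *
    field_simp
    grind
end

section
/- Let f_n(r) = √(2/π) · sin(2n arctan r)/r for r > 0. For every real p ∈ (3/2, ∞) there exists a constant C_p > 0 such that for every integer n ≥ 2: (i) if p < 3 then (∫₀^∞ |f_n(r)|^p r² dr)^{1/p} ≤ C_p n^{3/p − 1}; (ii) if p = 3 then (∫₀^∞ |f_n(r)|^p r² dr)^{1/p} ≤ C_p log n; (iii) if p > 3 then (∫₀^∞ |f_n(r)|^p r² dr)^{1/p} ≤ C_p n^{1 − 3/p}. -/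
open Real MeasureTheory

lemma abs_sin_two_mul_arctan_le_mul (n : ℕ) {r : ℝ} (hr : 0 < r) :
    |Real.sin (2 * n * arctan r)| ≤ 2 * n * r := by
  have h0 : 0 ≤ arctan r := arctan_nonneg.2 hr.le
  have h1 : arctan r ≤ r := by
    have := Real.le_tan h0 (arctan_lt_pi_div_two r)
    rwa [tan_arctan] at this
  calc |Real.sin (2 * n * arctan r)| ≤ |2 * n * arctan r| := Real.abs_sin_le_abs
    _ = 2 * n * arctan r := abs_of_nonneg (by positivity)
    _ ≤ 2 * n * r := by gcongr

lemma abs_sin_two_mul_arctan_inv (n : ℕ) {r : ℝ} (hr : 0 < r) :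
    |Real.sin (2 * n * arctan r⁻¹)| = |Real.sin (2 * n * arctan r)| := by
  rw [arctan_inv_of_pos hr,
    show 2 * (n : ℝ) * (π / 2 - arctan r) = n * π - 2 * n * arctan r by ring,
    Real.sin_nat_mul_pi_sub, abs_neg, abs_mul, abs_pow]
  simp

lemma abs_sin_two_mul_arctan_le_div (n : ℕ) {r : ℝ} (hr : 0 < r) :
    |Real.sin (2 * n * arctan r)| ≤ 2 * n / r := by
  rw [← abs_sin_two_mul_arctan_inv n hr, div_eq_mul_inv]
  exact abs_sin_two_mul_arctan_le_mul n (inv_pos.2 hr)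

lemma abs_profile_rpow_le {p r b : ℝ} (hp : 0 ≤ p) (hr : 0 < r) (n : ℕ)
    (hb : |Real.sin (2 * n * arctan r)| ≤ b) :
    |Real.sqrt (2 / π) * Real.sin (2 * n * arctan r) / r| ^ p * r ^ 2 ≤ (b / r) ^ p * r ^ 2 := by
  have hs : Real.sqrt (2 / π) ≤ 1 := by
    rw [Real.sqrt_le_one, div_le_one pi_pos]
    exact two_le_pi
  rw [abs_div, abs_mul, abs_of_pos hr, abs_of_nonneg (Real.sqrt_nonneg _)]
  gcongr
  exact (mul_le_of_le_one_left (abs_nonneg _) hs).trans hb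

/-- The contributions of `(0, 1/n]`, `(1/n, n]` and `(n, ∞)` to the integral. -/
lemma integral_profile_le {p : ℝ} (hp : 3 / 2 < p) {n : ℕ} (hn : 1 ≤ n) :
    ∫ r in Set.Ioi (0 : ℝ), |Real.sqrt (2 / π) * Real.sin (2 * n * arctan r) / r| ^ p * r ^ 2 ≤
      2 ^ p / 3 * (n : ℝ) ^ (p - 3) + (∫ r in (n : ℝ)⁻¹..n, r ^ (2 - p)) +
        2 ^ p / (2 * p - 3) * (n : ℝ) ^ (3 - p) := by
  have hn1 : (1 : ℝ) ≤ n := by exact_mod_cast hn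
  have hn0 : (0 : ℝ) < n := by linarith
  have hi0 : (0 : ℝ) < (n : ℝ)⁻¹ := inv_pos.2 hn0
  have hin : (n : ℝ)⁻¹ ≤ n := (inv_le_one_of_one_le₀ hn1).trans hn1
  have hp0 : 0 ≤ p := by linarith
  set A := (Set.Ioc 0 (n : ℝ)⁻¹).indicator fun r : ℝ => (2 * (n : ℝ)) ^ p * r ^ 2 with hA
  set B := (Set.Ioc (n : ℝ)⁻¹ n).indicator fun r : ℝ => r ^ (2 - p) with hB
  set D := (Set.Ioi (n : ℝ)).indicator fun r : ℝ => (2 * (n : ℝ)) ^ p * r ^ (2 - 2 * p) with hD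
  have iA : Integrable A := by
    rw [hA, integrable_indicator_iff measurableSet_Ioc,
      ← intervalIntegrable_iff_integrableOn_Ioc_of_le hi0.le]
    exact Continuous.intervalIntegrable (by fun_prop) _ _
  have iB : Integrable B := by
    rw [hB, integrable_indicator_iff measurableSet_Ioc,
      ← intervalIntegrable_iff_integrableOn_Ioc_of_le hin]
    refine intervalIntegral.intervalIntegrable_rpow (Or.inr ?_)
    rw [Set.uIcc_of_le hin]
    exact fun h => hi0.not_ge h.1
  have iD : Integrable D := by
    rw [hD, integrable_indicator_iff measurableSet_Ioi]
    exact (integrableOn_Ioi_rpow_of_lt (by linarith) hn0).const_mul _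
  have eA : ∫ r, A r = 2 ^ p / 3 * (n : ℝ) ^ (p - 3) := by
    rw [hA, integral_indicator measurableSet_Ioc, ← intervalIntegral.integral_of_le hi0.le,
      intervalIntegral.integral_const_mul, integral_pow, mul_rpow two_pos.le hn0.le,
      rpow_sub hn0, show (3 : ℝ) = (3 : ℕ) by norm_num, rpow_natCast]
    field_simp
    simp [hn0.ne']
    norm_num
  have eB : ∫ r, B r = ∫ r in (n : ℝ)⁻¹..n, r ^ (2 - p) := by
    rw [hB, integral_indicator measurableSet_Ioc, intervalIntegral.integral_of_le hin]
  have eD : ∫ r, D r = 2 ^ p / (2 * p - 3) * (n : ℝ) ^ (3 - p) := by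
    rw [hD, integral_indicator measurableSet_Ioi, integral_const_mul,
      integral_Ioi_rpow_of_lt (by linarith) hn0, mul_rpow two_pos.le hn0.le,
      show 3 - p = p + (2 - 2 * p + 1) by ring, rpow_add hn0 p,
      show 2 - 2 * p + 1 = -(2 * p - 3) by ring, neg_div_neg_eq]
    ring
  rw [← eA, ← eB, ← eD, ← integral_add iA iB, ← integral_add (f := fun r => A r + B r) (iA.add iB) iD,
    ← integral_indicator measurableSet_Ioi]
  refine integral_mono_of_nonneg (.of_forall fun r => ?_) ((iA.add iB).add iD)
    (.of_forall fun r => ?_)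
  · exact Set.indicator_nonneg (fun r _ => by positivity) r
  · rcases le_or_gt r 0 with h | hr
    · have h1 : ¬ (n : ℝ)⁻¹ < r := by linarith
      have h2 : ¬ (n : ℝ) < r := by linarith
      simp [hA, hB, hD, h.not_gt, h1, h2]
    simp only [Set.indicator, Set.mem_Ioi, hr, if_true, hA, hB, hD, Set.mem_Ioc, true_and]
    rcases le_or_gt r (n : ℝ)⁻¹ with h1 | h1
    · have h2 : ¬ (n : ℝ) < r := by linarith
      simp only [h1, h1.not_gt, h2, if_true, if_false, false_and, add_zero]
      refine (abs_profile_rpow_le hp0 hr n (abs_sin_two_mul_arctan_le_mul n hr)).trans_eq ?_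
      rw [mul_div_cancel_right₀ _ hr.ne']
    rcases le_or_gt r n with h2 | h2
    · simp only [h1, h1.not_ge, h2, h2.not_gt, if_true, if_false, true_and, add_zero, zero_add]
      refine (abs_profile_rpow_le hp0 hr n (Real.abs_sin_le_one _)).trans_eq ?_
      rw [one_div, inv_rpow hr.le, rpow_sub hr, rpow_two]
      ring
    · simp only [h1.not_ge, h2, h2.not_ge, if_true, if_false, and_false, zero_add]
      refine (abs_profile_rpow_le hp0 hr n (abs_sin_two_mul_arctan_le_div n hr)).trans_eq ?_
      rw [div_div, div_rpow (by positivity) (by positivity), mul_rpow hr.le hr.le, rpow_sub hr,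
        rpow_two, two_mul p, rpow_add hr]
      ring

lemma integral_inv_self_rpow {p x : ℝ} (hp : p ≠ 3) (hx : 1 ≤ x) :
    ∫ r in x⁻¹..x, r ^ (2 - p) = (x ^ (3 - p) - x ^ (p - 3)) / (3 - p) := by
  have hx0 : 0 < x := by linarith
  rw [integral_rpow, show 2 - p + 1 = 3 - p by ring, inv_rpow hx0.le, ← rpow_neg hx0.le, neg_sub]
  refine Or.inr ⟨fun h => hp (by linarith), fun h => ?_⟩
  rw [Set.uIcc_of_le ((inv_le_one_of_one_le₀ hx).trans hx)] at h
  exact (inv_pos.2 hx0).not_ge h.1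

lemma rpow_one_div_le_of_le_mul_rpow {p I K x s : ℝ} (hp : 0 < p) (hI : 0 ≤ I) (hK : 0 ≤ K)
    (hx : 0 ≤ x) (h : I ≤ K * x ^ s) : I ^ (1 / p) ≤ K ^ (1 / p) * x ^ (s / p) := by
  refine (rpow_le_rpow hI h (by positivity)).trans_eq ?_
  rw [mul_rpow hK (by positivity), ← rpow_mul hx, mul_one_div]

/-- Let `f_n(r) = √(2/π) sin (2n arctan r)/r`. For every `p ∈ (3/2,∞)`
there is `C_p > 0` such that for every `n ≥ 2`:
if `p < 3` then `(∫₀^∞ |f_n|^p r² dr)^{1/p} ≤ C_p n^{3/p−1}`;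
if `p = 3` then it is `≤ C_p log n`; and if `p > 3` then it is `≤ C_p n^{1−3/p}`. -/
theorem transformed_eigenfunction_Lp_bounds (p : ℝ) (hp : 3 / 2 < p) :
    ∃ C : ℝ, 0 < C ∧ ∀ n : ℕ, 2 ≤ n →
      ((p < 3 →
        (∫ r in Set.Ioi (0 : ℝ),
            |Real.sqrt (2 / π) * Real.sin (2 * n * arctan r) / r| ^ p * r ^ 2) ^ (1 / p)
          ≤ C * (n : ℝ) ^ (3 / p - 1)) ∧
       (p = 3 →
        (∫ r in Set.Ioi (0 : ℝ),
            |Real.sqrt (2 / π) * Real.sin (2 * n * arctan r) / r| ^ p * r ^ 2) ^ (1 / p)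
          ≤ C * Real.log n) ∧
       (3 < p →
        (∫ r in Set.Ioi (0 : ℝ),
            |Real.sqrt (2 / π) * Real.sin (2 * n * arctan r) / r| ^ p * r ^ 2) ^ (1 / p)
          ≤ C * (n : ℝ) ^ (1 - 3 / p))) := by
  have hp0 : 0 < p := by linarith
  have hq : 0 < 2 * p - 3 := by linarith
  have hI (n : ℕ) : 0 ≤ ∫ r in Set.Ioi (0 : ℝ),
      |Real.sqrt (2 / π) * Real.sin (2 * n * arctan r) / r| ^ p * r ^ 2 :=
    integral_nonneg fun r => by positivity
  rcases lt_trichotomy p 3 with h3 | h3 | h3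
  · have hd : 0 < 3 - p := by linarith
    set K := (2 : ℝ) ^ p / 3 + 1 / (3 - p) + 2 ^ p / (2 * p - 3) with hK
    refine ⟨K ^ (1 / p), by positivity, fun n hn => ⟨fun _ => ?_, fun h => absurd h h3.ne,
      fun h => absurd h h3.not_gt⟩⟩
    have hn1 : (1 : ℝ) ≤ n := by exact_mod_cast (by omega : 1 ≤ n)
    rw [show 3 / p - 1 = (3 - p) / p by field_simp]
    refine rpow_one_div_le_of_le_mul_rpow hp0 (hI n) (by positivity) (by positivity)
      ((integral_profile_le hp (by omega)).trans ?_)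
    rw [integral_inv_self_rpow h3.ne hn1, hK, add_mul, add_mul, one_div_mul_eq_div]
    gcongr
    exact sub_le_self _ (by positivity)
  · subst h3
    have hl2 : 0 < Real.log 2 := Real.log_pos one_lt_two
    set K := (2 : ℝ) ^ (3 : ℝ) / 3 + 2 ^ (3 : ℝ) / (2 * 3 - 3) with hK
    set L := K / Real.log 2 + 2 with hL
    have hK0 : 0 < K := by positivity
    refine ⟨L ^ (1 / 3 : ℝ) * Real.log 2 ^ (1 / 3 - 1 : ℝ), by positivity, fun n hn =>
      ⟨fun h => absurd h (lt_irrefl _), fun _ => ?_, fun h => absurd h (lt_irrefl _)⟩⟩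
    have hn0 : (0 : ℝ) < n := by exact_mod_cast (by omega : 0 < n)
    have hln : Real.log 2 ≤ Real.log n := Real.log_le_log two_pos (by exact_mod_cast hn)
    have hln0 : 0 < Real.log n := hl2.trans_le hln
    have hlog : ∫ r in (n : ℝ)⁻¹..n, r ^ (2 - 3 : ℝ) = 2 * Real.log n := by
      rw [show (2 - 3 : ℝ) = -1 by norm_num]
      simp only [rpow_neg_one]
      rw [integral_inv_of_pos (inv_pos.2 hn0) hn0, div_inv_eq_mul, Real.log_mul hn0.ne' hn0.ne']
      ring
    have hb := integral_profile_le hp (n := n) (by omega)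
    rw [hlog, sub_self, rpow_zero] at hb
    have hb' : ∫ r in Set.Ioi (0 : ℝ),
        |Real.sqrt (2 / π) * Real.sin (2 * n * arctan r) / r| ^ (3 : ℝ) * r ^ 2 ≤
          L * Real.log n ^ (1 : ℝ) := by
      have : K ≤ K / Real.log 2 * Real.log n := by
        rw [div_mul_eq_mul_div, le_div_iff₀ hl2]
        gcongr
      rw [rpow_one, hL, add_mul]
      linarith
    refine (rpow_one_div_le_of_le_mul_rpow hp0 (hI n) (by positivity) hln0.le hb').trans ?_
    rw [mul_assoc]
    gcongr
    calc Real.log n ^ (1 / 3 : ℝ) = Real.log n ^ (1 / 3 - 1 : ℝ) * Real.log n := by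
          rw [rpow_sub_one hln0.ne', div_mul_cancel₀ _ hln0.ne']
      _ ≤ Real.log 2 ^ (1 / 3 - 1 : ℝ) * Real.log n := by
          gcongr ?_ * _
          exact rpow_le_rpow_of_nonpos hl2 hln (by norm_num)
  · have hd : 0 < p - 3 := by linarith
    set K := (2 : ℝ) ^ p / 3 + 1 / (p - 3) + 2 ^ p / (2 * p - 3) with hK
    refine ⟨K ^ (1 / p), by positivity, fun n hn => ⟨fun h => absurd h h3.not_gt,
      fun h => absurd h h3.ne', fun _ => ?_⟩⟩
    have hn1 : (1 : ℝ) ≤ n := by exact_mod_cast (by omega : 1 ≤ n)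
    rw [show 1 - 3 / p = (p - 3) / p by field_simp]
    refine rpow_one_div_le_of_le_mul_rpow hp0 (hI n) (by positivity) (by positivity)
      ((integral_profile_le hp (by omega)).trans ?_)
    rw [integral_inv_self_rpow h3.ne' hn1, hK, add_mul, add_mul, one_div_mul_eq_div,
      ← neg_div_neg_eq (_ - _), neg_sub, neg_sub]
    gcongr
    exact sub_le_self _ (by positivity)
end

section
/- Let α ∈ (0,1), let r > 1/α be real, let r' = r/(r−1) be its conjugate exponent, and set ν = α − 1/r > 0. Let K > 0 and let Ψ : ℝ → ℝ be a 2π-periodic function that is differentiable on (0,2π) and satisfies |Ψ(u)| ≤ K (1 + u^{α−1}) and |Ψ'(u)| ≤ K (1 + u^{α−2}) for all u ∈ (0,2π). Then there exists a constant C > 0 (depending only on α, r and K) such that for all h ∈ (0,π), ∫₀^{2π} |Ψ(u+h) − Ψ(u)|^{r'} du ≤ C · h^{ν r'}. -/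
open Real

open MeasureTheory

theorem one_add_rpow_le_mul_rpow {u M s : ℝ} (hu : 0 < u) (huM : u ≤ M) (hs : s ≤ 0) :
    1 + u ^ s ≤ (1 + M ^ (-s)) * u ^ s := by
  have h1 : u ^ (-s) * u ^ s = 1 := by
    rw [← Real.rpow_add hu, neg_add_cancel, Real.rpow_zero]
  have h2 : u ^ (-s) ≤ M ^ (-s) := Real.rpow_le_rpow hu.le huM (by linarith)
  nlinarith [mul_le_mul_of_nonneg_right h2 (Real.rpow_nonneg hu.le s)]

/-- An increment is controlled by the two values when these satisfy a power bound. -/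
theorem abs_sub_rpow_le_of_abs_le {x y w v K M s p : ℝ} (hp : 0 ≤ p) (hs : s ≤ 0) (hK : 0 ≤ K)
    (hw : 0 < w) (hwv : w ≤ v) (hwM : w ≤ M)
    (hx : |x| ≤ K * (1 + w ^ s)) (hy : |y| ≤ K * (1 + v ^ s)) :
    |x - y| ^ p ≤ (2 * K * (1 + M ^ (-s))) ^ p * w ^ (s * p) := by
  have hvw : v ^ s ≤ w ^ s := Real.rpow_le_rpow_of_nonpos hw hwv hs
  have hM : 0 ≤ M ^ (-s) := Real.rpow_nonneg (hw.le.trans hwM) _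
  have hle : |x - y| ≤ 2 * K * (1 + M ^ (-s)) * w ^ s := by
    have h1 := abs_sub x y
    have h2 := mul_le_mul_of_nonneg_left hvw hK
    have h3 := mul_le_mul_of_nonneg_left (one_add_rpow_le_mul_rpow hw hwM hs) hK
    nlinarith
  calc |x - y| ^ p ≤ (2 * K * (1 + M ^ (-s)) * w ^ s) ^ p :=
        Real.rpow_le_rpow (abs_nonneg _) hle hp
    _ = _ := by
        rw [Real.mul_rpow (by positivity) (Real.rpow_nonneg hw.le _), ← Real.rpow_mul hw.le]

/-- An increment is controlled by the step length when the derivative satisfies a power bound. -/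
theorem abs_sub_rpow_le_of_abs_deriv_le {Ψ : ℝ → ℝ} {u h K M s p : ℝ} (hp : 0 ≤ p) (hs : s ≤ 0)
    (hK : 0 ≤ K) (hu : 0 < u) (hh : 0 ≤ h) (huh : u + h < M)
    (hd : ∀ v ∈ Set.Ioo 0 M, DifferentiableAt ℝ Ψ v)
    (hb : ∀ v ∈ Set.Ioo 0 M, |deriv Ψ v| ≤ K * (1 + v ^ s)) :
    |Ψ (u + h) - Ψ u| ^ p ≤ (K * (1 + M ^ (-s)) * h) ^ p * u ^ (s * p) := by
  have huM : u ≤ M := by linarith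
  have hM : 0 ≤ M ^ (-s) := Real.rpow_nonneg (hu.le.trans huM) _
  have hsub : ∀ v ∈ Set.Icc u (u + h), v ∈ Set.Ioo 0 M := fun v hv =>
    ⟨hu.trans_le hv.1, hv.2.trans_lt huh⟩
  have hle : |Ψ (u + h) - Ψ u| ≤ K * (1 + M ^ (-s)) * u ^ s * h := by
    have := Convex.norm_image_sub_le_of_norm_deriv_le (𝕜 := ℝ) (f := Ψ)
      (C := K * (1 + M ^ (-s)) * u ^ s) (s := Set.Icc u (u + h)) (x := u) (y := u + h)
      (fun v hv => hd v (hsub v hv)) (fun v hv => ?_) (convex_Icc _ _)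
      (Set.left_mem_Icc.2 (by linarith)) (Set.right_mem_Icc.2 (by linarith))
    · simpa [Real.norm_eq_abs, abs_of_nonneg hh] using this
    · have h1 := hb v (hsub v hv)
      have h2 : v ^ s ≤ u ^ s := Real.rpow_le_rpow_of_nonpos hu hv.1 hs
      have h3 := one_add_rpow_le_mul_rpow hu huM hs
      rw [Real.norm_eq_abs, mul_assoc]
      exact h1.trans (mul_le_mul_of_nonneg_left (by linarith) hK)
  calc |Ψ (u + h) - Ψ u| ^ p ≤ (K * (1 + M ^ (-s)) * u ^ s * h) ^ p :=
        Real.rpow_le_rpow (abs_nonneg _) hle hp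
    _ = (K * (1 + M ^ (-s)) * h * u ^ s) ^ p := by ring_nf
    _ = _ := by
        rw [Real.mul_rpow (by positivity) (Real.rpow_nonneg hu.le _), ← Real.rpow_mul hu.le]

theorem integral_rpow_zero_left {s h : ℝ} (hs : -1 < s) :
    ∫ u in (0 : ℝ)..h, u ^ s = h ^ (s + 1) / (s + 1) := by
  rw [integral_rpow (Or.inl hs), Real.zero_rpow (by linarith), sub_zero]

theorem integral_rpow_le_of_lt_neg_one {s a b : ℝ} (hs : s < -1) (ha : 0 < a) (hab : a ≤ b) :
    ∫ u in a..b, u ^ s ≤ a ^ (s + 1) / (-(s + 1)) := by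
  have h0 : (0 : ℝ) ∉ Set.uIcc a b := by
    rw [Set.uIcc_of_le hab]; exact fun h => ha.not_ge h.1
  rw [integral_rpow (Or.inr ⟨hs.ne, h0⟩), div_neg, ← neg_div,
    div_le_div_right_of_neg (by linarith)]
  linarith [Real.rpow_nonneg (ha.le.trans hab) (s + 1)]

/-- Let `α ∈ (0,1)`, `r > 1/α`, `r' = r/(r−1)`, `ν = α − 1/r`, `K > 0`.
There is a constant `C > 0` depending only on `α, r, K` such that every 2π-periodic `Ψ`,
differentiable on `(0,2π)` with `|Ψ(u)| ≤ K(1+u^{α−1})` and `|Ψ'(u)| ≤ K(1+u^{α−2})`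
there, satisfies `∫₀^{2π} |Ψ(u+h) − Ψ(u)|^{r'} du ≤ C h^{ν r'}` for all `h ∈ (0,π)`. -/
theorem kernel_increment_bound (α r K : ℝ) (hα0 : 0 < α) (hα1 : α < 1)
    (hr : 1 / α < r) (hK : 0 < K) :
    ∃ C : ℝ, 0 < C ∧ ∀ Ψ : ℝ → ℝ,
      (∀ u : ℝ, Ψ (u + 2 * π) = Ψ u) →
      (∀ u ∈ Set.Ioo (0 : ℝ) (2 * π), DifferentiableAt ℝ Ψ u) →
      (∀ u ∈ Set.Ioo (0 : ℝ) (2 * π), |Ψ u| ≤ K * (1 + u ^ (α - 1))) →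
      (∀ u ∈ Set.Ioo (0 : ℝ) (2 * π), |deriv Ψ u| ≤ K * (1 + u ^ (α - 2))) →
      ∀ h ∈ Set.Ioo (0 : ℝ) π,
        (∫ u in (0 : ℝ)..(2 * π), |Ψ (u + h) - Ψ u| ^ (r / (r - 1)))
          ≤ C * h ^ ((α - 1 / r) * (r / (r - 1))) := by
  set p := r / (r - 1) with hp
  have hr1 : 1 < r := lt_of_le_of_lt (by rw [le_div_iff₀ hα0]; linarith) hr
  have hαr : 1 < α * r := by rwa [div_lt_iff₀' hα0] at hr
  have hp1 : 1 < p := by rw [hp, lt_div_iff₀ (by linarith)]; linarith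
  have hp0 : 0 ≤ p := by linarith
  have hβ : (α - 1 / r) * p = (α - 1) * p + 1 := by
    have : r - 1 ≠ 0 := by linarith
    rw [hp]; field_simp; ring
  have hβ0 : 0 < (α - 1) * p + 1 := by
    rw [← hβ]
    refine mul_pos ?_ (by linarith)
    rw [sub_pos, div_lt_iff₀ (by linarith)]; exact hαr
  have hs₁ : -1 < (α - 1) * p := by linarith
  have hs₂ : (α - 2) * p < -1 := by nlinarith
  have hC0 : 0 < -((α - 2) * p + 1) := by linarith
  rw [hβ]
  set A := (2 * K * (1 + (2 * π) ^ (-(α - 1)))) ^ p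
  set B := K * (1 + (2 * π) ^ (-(α - 2)))
  have hA0 : 0 < A := by positivity
  have hB0 : 0 < B := by positivity
  refine ⟨2 * (A / ((α - 1) * p + 1)) + B ^ p / (-((α - 2) * p + 1)), ?_, ?_⟩
  · positivity
  rintro Ψ hper hdiff hbd hbd' h ⟨hh0, hhπ⟩
  by_cases hint : IntervalIntegrable (fun u => |Ψ (u + h) - Ψ u| ^ p) volume 0 (2 * π)
  swap
  · rw [intervalIntegral.integral_undef hint]
    positivity
  have hi : ∀ a b : ℝ, 0 ≤ a → a ≤ b → b ≤ 2 * π →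
      IntervalIntegrable (fun u => |Ψ (u + h) - Ψ u| ^ p) volume a b := fun a b h1 h2 h3 =>
    hint.mono_set (by
      rw [Set.uIcc_of_le h2, Set.uIcc_of_le (by positivity)]
      exact Set.Icc_subset_Icc h1 h3)
  have hi₁ := hi 0 h le_rfl hh0.le (by linarith)
  have hi₂ := hi h (2 * π - h) hh0.le (by linarith) (by linarith)
  have hi₃ := hi (2 * π - h) (2 * π) (by linarith) (by linarith) le_rfl
  have hpow : IntervalIntegrable (fun u : ℝ => u ^ ((α - 1) * p)) volume 0 h :=
    intervalIntegral.intervalIntegrable_rpow' hs₁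
  have h₁ : ∫ u in (0 : ℝ)..h, |Ψ (u + h) - Ψ u| ^ p ≤
      A / ((α - 1) * p + 1) * h ^ ((α - 1) * p + 1) := by
    calc _ ≤ ∫ u in (0 : ℝ)..h, A * u ^ ((α - 1) * p) := by
          refine intervalIntegral.integral_mono_on_of_le_Ioo hh0.le hi₁ (hpow.const_mul A) ?_
          rintro u ⟨hu0, huh⟩
          rw [abs_sub_comm]
          exact abs_sub_rpow_le_of_abs_le hp0 (by linarith) hK.le hu0 (by linarith)
            (by linarith) (hbd u ⟨hu0, by linarith⟩) (hbd (u + h) ⟨by linarith, by linarith⟩)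
      _ = _ := by
          rw [intervalIntegral.integral_const_mul, integral_rpow_zero_left hs₁]; ring
  have h₂ : ∫ u in h..(2 * π - h), |Ψ (u + h) - Ψ u| ^ p ≤
      B ^ p / (-((α - 2) * p + 1)) * h ^ ((α - 1) * p + 1) := by
    have h0 : (0 : ℝ) ∉ Set.uIcc h (2 * π - h) := by
      rw [Set.uIcc_of_le (by linarith)]; exact fun h' => hh0.not_ge h'.1
    calc _ ≤ ∫ u in h..(2 * π - h), (B * h) ^ p * u ^ ((α - 2) * p) := by
          refine intervalIntegral.integral_mono_on_of_le_Ioo (by linarith) hi₂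
            ((intervalIntegral.intervalIntegrable_rpow (Or.inr h0)).const_mul _) ?_
          rintro u ⟨hu0, huh⟩
          exact abs_sub_rpow_le_of_abs_deriv_le hp0 (by linarith) hK.le (by linarith) hh0.le
            (by linarith) hdiff hbd'
      _ ≤ (B * h) ^ p * (h ^ ((α - 2) * p + 1) / (-((α - 2) * p + 1))) := by
          rw [intervalIntegral.integral_const_mul]
          exact mul_le_mul_of_nonneg_left
            (integral_rpow_le_of_lt_neg_one hs₂ hh0 (by linarith)) (by positivity)
      _ = _ := by
          have he : (α - 1) * p + 1 = p + ((α - 2) * p + 1) := by ring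
          rw [he, Real.rpow_add hh0 p, Real.mul_rpow hB0.le hh0.le, mul_div_assoc',
            div_mul_eq_mul_div, mul_assoc]
  have h₃ : ∫ u in (2 * π - h)..(2 * π), |Ψ (u + h) - Ψ u| ^ p ≤
      A / ((α - 1) * p + 1) * h ^ ((α - 1) * p + 1) := by
    have hpow' : IntervalIntegrable (fun u : ℝ => (u - (2 * π - h)) ^ ((α - 1) * p)) volume
        (2 * π - h) (2 * π) := by
      simpa using hpow.comp_sub_right (2 * π - h)
    calc _ ≤ ∫ u in (2 * π - h)..(2 * π), A * (u - (2 * π - h)) ^ ((α - 1) * p) := by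
          refine intervalIntegral.integral_mono_on_of_le_Ioo (by linarith) hi₃
            (hpow'.const_mul A) ?_
          rintro u ⟨hu0, huh⟩
          have hshift : Ψ (u + h) = Ψ (u - (2 * π - h)) := by
            rw [← hper (u - (2 * π - h))]; congr 1; ring
          rw [hshift]
          exact abs_sub_rpow_le_of_abs_le hp0 (by linarith) hK.le (by linarith) (by linarith)
            (by linarith) (hbd _ ⟨by linarith, by linarith⟩) (hbd u ⟨by linarith, huh⟩)
      _ = _ := by
          rw [intervalIntegral.integral_const_mul,
            intervalIntegral.integral_comp_sub_right (fun u => u ^ ((α - 1) * p)), sub_self,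
            sub_sub_cancel, integral_rpow_zero_left hs₁]
          ring
  rw [← intervalIntegral.integral_add_adjacent_intervals (hi₁.trans hi₂) hi₃,
    ← intervalIntegral.integral_add_adjacent_intervals hi₁ hi₂]
  linarith
end

section
/- Let α ∈ (0,1), let r > 1/α be real, let r' = r/(r−1), and set ν = α − 1/r > 0. Let K > 0 and let Ψ : ℝ → ℝ be a 2π-periodic function, differentiable on (0,2π), with |Ψ(u)| ≤ K (1 + u^{α−1}) and |Ψ'(u)| ≤ K (1 + u^{α−2}) for all u ∈ (0,2π). Let f : ℝ → ℝ be 2π-periodic with ∫₀^{2π} |f(t)|^r dt < ∞, and define g(x) = (1/2π) ∫₀^{2π} f(t) Ψ(x−t) dt. Then there exists a constant C > 0 (depending only on α, r and K) such that for all x ∈ ℝ and all h ∈ (0,π), |g(x+h) − g(x)| ≤ C ( ∫₀^{2π} |f(t)|^r dt )^{1/r} · h^ν; that is, g is Hölder continuous of exponent ν = α − 1/r. -/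
open Real MeasureTheory

lemma one_add_rpow_le_mul_rpow_s19 {T u β : ℝ} (hu : 0 < u) (huT : u ≤ T) (hT : 1 ≤ T)
    (hβ₂ : -2 ≤ β) (hβ₀ : β ≤ 0) : 1 + u ^ β ≤ (1 + T ^ 2) * u ^ β := by
  have hpos : 0 < u ^ β := rpow_pos_of_pos hu β
  have h₁ : u ^ (-β) ≤ T ^ 2 := by
    calc u ^ (-β) ≤ T ^ (-β) := rpow_le_rpow hu.le huT (by linarith)
      _ ≤ T ^ (2 : ℝ) := rpow_le_rpow_of_exponent_le hT (by linarith)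
      _ = T ^ 2 := by norm_cast
  have h₂ : u ^ (-β) * u ^ β = 1 := by rw [← rpow_add hu]; simp
  nlinarith [mul_le_mul_of_nonneg_right h₁ hpos.le]

lemma intervalIntegrable_of_abs_le_on_Ioo {F G : ℝ → ℝ} {a b : ℝ} (hab : a ≤ b)
    (hF : ContinuousOn F (Set.Ioo a b)) (hG : IntervalIntegrable G volume a b)
    (hFG : ∀ u ∈ Set.Ioo a b, |F u| ≤ G u) : IntervalIntegrable F volume a b := by
  rw [intervalIntegrable_iff_integrableOn_Ioo_of_le hab] at hG ⊢
  refine Integrable.mono' hG (hF.aestronglyMeasurable measurableSet_Ioo) ?_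
  filter_upwards [ae_restrict_mem measurableSet_Ioo] with u hu using hFG u hu

lemma memLp_Ioc_of_intervalIntegrable_abs_rpow {F : ℝ → ℝ} {a b q : ℝ} (hab : a ≤ b) (hq : 0 < q)
    (hF : AEStronglyMeasurable F (volume.restrict (Set.Ioc a b)))
    (hFq : IntervalIntegrable (fun u => |F u| ^ q) volume a b) :
    MemLp F (ENNReal.ofReal q) (volume.restrict (Set.Ioc a b)) := by
  rw [← integrable_norm_rpow_iff hF (by simpa using hq) ENNReal.ofReal_ne_top,
    ENNReal.toReal_ofReal hq.le]
  exact (intervalIntegrable_iff_integrableOn_Ioc_of_le hab).1 hFq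

lemma intervalIntegrable_abs_rpow_of_memLp_Ioc {F : ℝ → ℝ} {a b q : ℝ} (hab : a ≤ b) (hq : 0 < q)
    (hF : MemLp F (ENNReal.ofReal q) (volume.restrict (Set.Ioc a b))) :
    IntervalIntegrable (fun u => |F u| ^ q) volume a b := by
  rw [← integrable_norm_rpow_iff hF.1 (by simpa using hq) ENNReal.ofReal_ne_top,
    ENNReal.toReal_ofReal hq.le] at hF
  exact (intervalIntegrable_iff_integrableOn_Ioc_of_le hab).2 hF

lemma integral_abs_rpow_le_of_abs_le_rpow {F : ℝ → ℝ} {a b q M β : ℝ} (ha : 0 ≤ a) (hab : a ≤ b)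
    (hq : 0 < q) (hM : 0 ≤ M) (hF : IntervalIntegrable (fun u => |F u| ^ q) volume a b)
    (hβ : IntervalIntegrable (fun u => u ^ (β * q)) volume a b)
    (hFβ : ∀ u ∈ Set.Ioo a b, |F u| ≤ M * u ^ β) :
    ∫ u in a..b, |F u| ^ q ≤ M ^ q * ∫ u in a..b, u ^ (β * q) := by
  rw [← intervalIntegral.integral_const_mul]
  refine intervalIntegral.integral_mono_on_of_le_Ioo hab hF (hβ.const_mul _) fun u hu => ?_
  have hu₀ : 0 < u := ha.trans_lt hu.1
  calc |F u| ^ q ≤ (M * u ^ β) ^ q := rpow_le_rpow (abs_nonneg _) (hFβ u hu) hq.le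
    _ = M ^ q * u ^ (β * q) := by
      rw [mul_rpow hM (rpow_nonneg hu₀.le _), ← rpow_mul hu₀.le]

/-- The modulus of continuity in `L^q` of a kernel with a singularity of order `β` at the
endpoints of its period. -/
lemma integral_abs_sub_rpow_le {Ψ : ℝ → ℝ} {T K β q h : ℝ} (hK : 0 ≤ K) (hq : 0 < q)
    (hβ₀ : β ≤ 0) (hβq : -1 < β * q) (hβq' : (β - 1) * q < -1)
    (hΨ : Function.Periodic Ψ T)
    (hdiff : ∀ u ∈ Set.Ioo 0 T, DifferentiableAt ℝ Ψ u)
    (hbound : ∀ u ∈ Set.Ioo 0 T, |Ψ u| ≤ K * u ^ β)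
    (hderiv : ∀ u ∈ Set.Ioo 0 T, |deriv Ψ u| ≤ K * u ^ (β - 1))
    (hh : 0 < h) (hhT : 2 * h < T)
    (hint : ∀ a b : ℝ, IntervalIntegrable (fun u => |Ψ (u + h) - Ψ u| ^ q) volume a b) :
    ∫ u in 0..T, |Ψ (u + h) - Ψ u| ^ q
      ≤ (2 * K) ^ q * (2 / (β * q + 1) + 1 / (-((β - 1) * q + 1))) * h ^ (β * q + 1) := by
  have hpow : ∫ u in 0..h, u ^ (β * q) = h ^ (β * q + 1) / (β * q + 1) := by
    rw [integral_rpow (Or.inl hβq), zero_rpow (by linarith), sub_zero]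
  have hnear : ∫ u in 0..h, |Ψ (u + h) - Ψ u| ^ q
      ≤ (2 * K) ^ q * (h ^ (β * q + 1) / (β * q + 1)) := by
    rw [← hpow]
    refine integral_abs_rpow_le_of_abs_le_rpow le_rfl hh.le hq (by positivity) (hint _ _)
      (intervalIntegral.intervalIntegrable_rpow' hβq) fun u hu => ?_
    have h₁ := hbound u ⟨hu.1, by linarith [hu.2]⟩
    have h₂ := hbound (u + h) ⟨by linarith [hu.1], by linarith [hu.2]⟩
    have h₃ : (u + h) ^ β ≤ u ^ β := rpow_le_rpow_of_nonpos hu.1 (by linarith) hβ₀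
    have h₄ := mul_le_mul_of_nonneg_left h₃ hK
    linarith [abs_sub (Ψ (u + h)) (Ψ u)]
  have hfar : ∫ u in (T - h)..T, |Ψ (u + h) - Ψ u| ^ q
      ≤ (2 * K) ^ q * (h ^ (β * q + 1) / (β * q + 1)) := by
    have hshift : ∫ u in (T - h)..T, |Ψ (u + h) - Ψ u| ^ q
        = ∫ v in 0..h, |Ψ v - Ψ (v + (T - h))| ^ q := by
      have := intervalIntegral.integral_comp_add_right (a := 0) (b := h)
        (fun u => |Ψ (u + h) - Ψ u| ^ q) (T - h)
      rw [zero_add, add_sub_cancel] at this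
      rw [← this]
      refine intervalIntegral.integral_congr fun v _ => ?_
      have : Ψ (v + (T - h) + h) = Ψ v := by rw [← hΨ v]; congr 1; ring
      simp only [this]
    have hint' : IntervalIntegrable (fun v => |Ψ v - Ψ (v + (T - h))| ^ q) volume 0 h := by
      have := (hint (T - h) T).comp_add_right (T - h)
      rw [sub_self, sub_sub_cancel] at this
      refine this.congr fun v _ => ?_
      have : Ψ (v + (T - h) + h) = Ψ v := by rw [← hΨ v]; congr 1; ring
      simp only [this]
    rw [hshift, ← hpow]
    refine integral_abs_rpow_le_of_abs_le_rpow le_rfl hh.le hq (by positivity) hint'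
      (intervalIntegral.intervalIntegrable_rpow' hβq) fun u hu => ?_
    have h₁ := hbound u ⟨hu.1, by linarith [hu.2]⟩
    have h₂ := hbound (u + (T - h)) ⟨by linarith [hu.1], by linarith [hu.2]⟩
    have h₃ : (u + (T - h)) ^ β ≤ u ^ β := rpow_le_rpow_of_nonpos hu.1 (by linarith) hβ₀
    have h₄ := mul_le_mul_of_nonneg_left h₃ hK
    linarith [abs_sub (Ψ u) (Ψ (u + (T - h)))]
  have hmid : ∫ u in h..(T - h), |Ψ (u + h) - Ψ u| ^ q
      ≤ (2 * K) ^ q * (h ^ (β * q + 1) / (-((β - 1) * q + 1))) := by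
    have hzero : (0 : ℝ) ∉ Set.uIcc h (T - h) := by
      rw [Set.uIcc_of_le (by linarith)]
      exact fun h₀ => hh.not_ge h₀.1
    have hle := integral_abs_rpow_le_of_abs_le_rpow (F := fun u => Ψ (u + h) - Ψ u) (b := T - h)
      (M := K * h) (β := β - 1) hh.le (by linarith) hq (by positivity) (hint _ _)
      (intervalIntegral.intervalIntegrable_rpow (Or.inr hzero)) fun u hu => by
        have hu₀ : 0 < u := hh.trans hu.1
        have hsub : Set.Icc u (u + h) ⊆ Set.Ioo 0 T := fun w hw =>
          ⟨hu₀.trans_le hw.1, hw.2.trans_lt (by linarith [hu.2])⟩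
        have := (convex_Icc u (u + h)).norm_image_sub_le_of_norm_deriv_le (f := Ψ)
          (C := K * u ^ (β - 1)) (x := u) (y := u + h) (fun w hw => hdiff w (hsub hw))
          (fun w hw => (hderiv w (hsub hw)).trans (mul_le_mul_of_nonneg_left
            (rpow_le_rpow_of_nonpos hu₀ hw.1 (by linarith)) hK))
          ⟨le_rfl, by linarith⟩ ⟨by linarith, le_rfl⟩
        simp only [norm_eq_abs, add_sub_cancel_left, abs_of_pos hh] at this
        linarith
    refine hle.trans ?_
    rw [integral_rpow (Or.inr ⟨by linarith, hzero⟩), mul_rpow hK hh.le, mul_rpow two_pos.le hK]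
    have hneg : 0 < -((β - 1) * q + 1) := by linarith
    have h₁ : ((T - h) ^ ((β - 1) * q + 1) - h ^ ((β - 1) * q + 1)) / ((β - 1) * q + 1)
        ≤ h ^ ((β - 1) * q + 1) / (-((β - 1) * q + 1)) := by
      rw [← neg_div_neg_eq]
      refine div_le_div_of_nonneg_right ?_ hneg.le
      linarith [rpow_nonneg (show 0 ≤ T - h by linarith) ((β - 1) * q + 1)]
    have h₂ : h ^ (β * q + 1) = h ^ q * h ^ ((β - 1) * q + 1) := by
      rw [← rpow_add hh]; congr 1; ring
    have h₃ : (1 : ℝ) ≤ 2 ^ q := one_le_rpow one_le_two hq.le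
    have h₄ : 0 ≤ K ^ q * h ^ q := by positivity
    calc _ ≤ K ^ q * h ^ q * (h ^ ((β - 1) * q + 1) / (-((β - 1) * q + 1))) :=
          mul_le_mul_of_nonneg_left h₁ h₄
      _ ≤ 2 ^ q * (K ^ q * h ^ q * (h ^ ((β - 1) * q + 1) / (-((β - 1) * q + 1)))) :=
          le_mul_of_one_le_left (by positivity) h₃
      _ = _ := by rw [h₂]; ring
  rw [← intervalIntegral.integral_add_adjacent_intervals (hint 0 h) (hint h T),
    ← intervalIntegral.integral_add_adjacent_intervals (hint h (T - h)) (hint (T - h) T)]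
  calc _ ≤ (2 * K) ^ q * (h ^ (β * q + 1) / (β * q + 1))
        + ((2 * K) ^ q * (h ^ (β * q + 1) / (-((β - 1) * q + 1)))
          + (2 * K) ^ q * (h ^ (β * q + 1) / (β * q + 1))) := by gcongr
    _ = _ := by ring

lemma integral_mul_comp_sub_eq {f Ψ : ℝ → ℝ} {T : ℝ} (hf : Function.Periodic f T)
    (hΨ : Function.Periodic Ψ T) (x y : ℝ) :
    ∫ t in 0..T, f t * Ψ (y - t) = ∫ u in 0..T, f (x - u) * Ψ (u + (y - x)) := by
  have hper : Function.Periodic (fun t => f t * Ψ (y - t)) T := fun t => by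
    simp only [hf t, ← sub_sub, hΨ.sub_eq]
  have h₁ := intervalIntegral.integral_comp_sub_left (a := 0) (b := T)
    (fun t => f t * Ψ (y - t)) x
  have h₂ := hper.intervalIntegral_add_eq (x - T) 0
  rw [sub_add_cancel, zero_add] at h₂
  rw [sub_zero, h₂] at h₁
  rw [← h₁]
  refine intervalIntegral.integral_congr fun u _ => ?_
  simp only [show y - (x - u) = u + (y - x) by ring]

/-- Let `α ∈ (0,1)`, `r > 1/α`, `ν = α − 1/r`, `K > 0`. There is
`C > 0` depending only on `α, r, K` such that for every 2π-periodic `Ψ`, differentiable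
on `(0,2π)` with `|Ψ(u)| ≤ K(1+u^{α−1})`, `|Ψ'(u)| ≤ K(1+u^{α−2})` there, and every
2π-periodic `f` with `∫₀^{2π} |f|^r < ∞`, the fractional integral
`g(x) = (1/2π) ∫₀^{2π} f(t) Ψ(x−t) dt` satisfies, for all `x` and `h ∈ (0,π)`,
`|g(x+h) − g(x)| ≤ C (∫₀^{2π} |f|^r)^{1/r} h^ν`: `g` is `ν`-Hölder continuous. -/
theorem fractional_integral_holder (α r K : ℝ) (hα0 : 0 < α) (hα1 : α < 1)
    (hr : 1 / α < r) (hK : 0 < K) :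
    ∃ C : ℝ, 0 < C ∧ ∀ Ψ f : ℝ → ℝ,
      (∀ u : ℝ, Ψ (u + 2 * π) = Ψ u) →
      (∀ u ∈ Set.Ioo (0 : ℝ) (2 * π), DifferentiableAt ℝ Ψ u) →
      (∀ u ∈ Set.Ioo (0 : ℝ) (2 * π), |Ψ u| ≤ K * (1 + u ^ (α - 1))) →
      (∀ u ∈ Set.Ioo (0 : ℝ) (2 * π), |deriv Ψ u| ≤ K * (1 + u ^ (α - 2))) →
      (∀ t : ℝ, f (t + 2 * π) = f t) →
      Measurable f →
      IntervalIntegrable (fun t => |f t| ^ r) volume 0 (2 * π) →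
      ∀ x : ℝ, ∀ h ∈ Set.Ioo (0 : ℝ) π,
        |(1 / (2 * π)) * (∫ t in (0 : ℝ)..(2 * π), f t * Ψ (x + h - t))
          - (1 / (2 * π)) * (∫ t in (0 : ℝ)..(2 * π), f t * Ψ (x - t))|
          ≤ C * (∫ t in (0 : ℝ)..(2 * π), |f t| ^ r) ^ (1 / r) * h ^ (α - 1 / r) := by
  have hπ : 1 ≤ 2 * π := by linarith [pi_gt_three]
  have hT : 0 < 2 * π := by linarith
  have hr₁ : 1 < r := (one_lt_one_div hα0 hα1).trans hr
  have hr₀ : 0 < r := by linarith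
  have hαr : 1 < α * r := by rwa [div_lt_iff₀' hα0] at hr
  obtain ⟨q, hrq⟩ : ∃ q, r.HolderConjugate q := ⟨_, .conjExponent hr₁⟩
  have hq : 0 < q := hrq.symm.pos
  have hq₁ : 1 < q := hrq.symm.lt
  have hexp : (α - 1) * q + 1 = (α - 1 / r) * q := by
    have := hrq.inv_add_inv_eq_one
    field_simp at this ⊢
    linarith
  have hν : 0 < α - 1 / r := by
    rw [sub_pos, div_lt_iff₀ hr₀]; exact hαr
  have hβq : -1 < (α - 1) * q := by linarith [mul_pos hν hq]
  have hβq' : (α - 1 - 1) * q < -1 := by nlinarith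
  set A : ℝ := 1 + (2 * π) ^ 2 with hA
  have hApos : 0 < A := by positivity
  set B : ℝ := 2 / ((α - 1) * q + 1) + 1 / (-((α - 1 - 1) * q + 1)) with hB
  have hBpos : 0 < B :=
    add_pos (div_pos two_pos (by linarith)) (div_pos one_pos (by linarith))
  refine ⟨1 / (2 * π) * (2 * (K * A) * B ^ (1 / q)), by positivity, ?_⟩
  intro Ψ f hΨ hdiff hbound hderiv hf hfm hfr x h hh
  have hbound' : ∀ u ∈ Set.Ioo 0 (2 * π), |Ψ u| ≤ K * A * u ^ (α - 1) := fun u hu => by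
    rw [mul_assoc]
    exact (hbound u hu).trans (mul_le_mul_of_nonneg_left
      (one_add_rpow_le_mul_rpow_s19 hu.1 hu.2.le hπ (by linarith) (by linarith)) hK.le)
  have hderiv' : ∀ u ∈ Set.Ioo 0 (2 * π), |deriv Ψ u| ≤ K * A * u ^ (α - 1 - 1) := fun u hu => by
    rw [mul_assoc, show α - 1 - 1 = α - 2 by ring]
    exact (hderiv u hu).trans (mul_le_mul_of_nonneg_left
      (one_add_rpow_le_mul_rpow_s19 hu.1 hu.2.le hπ (by linarith) (by linarith)) hK.le)
  have hcont : ContinuousOn Ψ (Set.Ioo 0 (2 * π)) := fun u hu =>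
    (hdiff u hu).continuousAt.continuousWithinAt
  have hΨint : ∀ a b, IntervalIntegrable Ψ volume a b :=
    Function.Periodic.intervalIntegrable (t := 0) hΨ hT.ne' <| by
      rw [zero_add]
      exact intervalIntegrable_of_abs_le_on_Ioo hT.le hcont
        ((intervalIntegral.intervalIntegrable_rpow' (by linarith)).const_mul _) hbound'
  have hΨq : ∀ a b, IntervalIntegrable (fun u => |Ψ u| ^ q) volume a b :=
    Function.Periodic.intervalIntegrable (t := 0) (T := 2 * π) (fun u => by simp only [hΨ u])
      hT.ne' <| by
      rw [zero_add]
      refine intervalIntegrable_of_abs_le_on_Ioo hT.le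
        (hcont.abs.rpow_const fun _ _ => Or.inr hq.le)
        ((intervalIntegral.intervalIntegrable_rpow' hβq).const_mul ((K * A) ^ q)) fun u hu => ?_
      rw [abs_of_nonneg (by positivity), rpow_mul hu.1.le,
        ← mul_rpow (by positivity) (rpow_nonneg hu.1.le _)]
      exact rpow_le_rpow (abs_nonneg _) (hbound' u hu) hq.le
  have hΨmem : ∀ c a b : ℝ, a ≤ b → MemLp (fun u => Ψ (u + c)) (ENNReal.ofReal q)
      (volume.restrict (Set.Ioc a b)) := fun c a b hab => by
    refine memLp_Ioc_of_intervalIntegrable_abs_rpow hab hq ?_ ?_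
    · have := (hΨint (a + c) (b + c)).comp_add_right c
      rw [add_sub_cancel_right, add_sub_cancel_right] at this
      exact this.1.aestronglyMeasurable
    · have := (hΨq (a + c) (b + c)).comp_add_right c
      rwa [add_sub_cancel_right, add_sub_cancel_right] at this
  have hDmem : ∀ a b : ℝ, a ≤ b → MemLp (fun u => Ψ (u + h) - Ψ u) (ENNReal.ofReal q)
      (volume.restrict (Set.Ioc a b)) := fun a b hab => by
    simpa using! (hΨmem h a b hab).sub (hΨmem 0 a b hab)
  have hDint : ∀ a b : ℝ, IntervalIntegrable (fun u => |Ψ (u + h) - Ψ u| ^ q) volume a b := by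
    intro a b
    rcases le_total a b with hab | hab
    · exact intervalIntegrable_abs_rpow_of_memLp_Ioc hab hq (hDmem a b hab)
    · exact (intervalIntegrable_abs_rpow_of_memLp_Ioc hab hq (hDmem b a hab)).symm
  have hfper : Function.Periodic (fun t => |f t| ^ r) (2 * π) := fun t => by simp only [hf t]
  have hfint : IntervalIntegrable (fun u => |f (x - u)| ^ r) volume 0 (2 * π) := by
    have := (hfper.intervalIntegrable (t := 0) hT.ne' (by rwa [zero_add])
      x (x - 2 * π)).comp_sub_left x
    rwa [sub_self, sub_sub_cancel] at this
  have hfnorm : ∫ u in 0..(2 * π), |f (x - u)| ^ r = ∫ t in 0..(2 * π), |f t| ^ r := by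
    have := hfper.intervalIntegral_add_eq (x - 2 * π) 0
    rw [sub_add_cancel, zero_add] at this
    rw [← this, intervalIntegral.integral_comp_sub_left (fun t => |f t| ^ r) x, sub_zero]
  have hfmem : MemLp (fun u => f (x - u)) (ENNReal.ofReal r)
      (volume.restrict (Set.Ioc 0 (2 * π))) :=
    memLp_Ioc_of_intervalIntegrable_abs_rpow hT.le hr₀
      (hfm.comp (measurable_const.sub measurable_id)).aestronglyMeasurable hfint
  have : (ENNReal.ofReal r).HolderTriple (ENNReal.ofReal q) 1 := hrq.ennrealOfReal
  have hprod : ∀ c, IntervalIntegrable (fun u => f (x - u) * Ψ (u + c)) volume 0 (2 * π) :=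
    fun c => (intervalIntegrable_iff_integrableOn_Ioc_of_le hT.le).2
      (hfmem.integrable_mul (hΨmem c _ _ hT.le))
  have hdiffeq : (∫ t in 0..(2 * π), f t * Ψ (x + h - t)) - ∫ t in 0..(2 * π), f t * Ψ (x - t)
      = ∫ u in 0..(2 * π), f (x - u) * (Ψ (u + h) - Ψ u) := by
    rw [integral_mul_comp_sub_eq hf hΨ x (x + h), integral_mul_comp_sub_eq hf hΨ x x,
      ← intervalIntegral.integral_sub (hprod _) (hprod _)]
    simp only [add_sub_cancel_left, sub_self, add_zero, mul_sub]
  have hholder : |∫ u in 0..(2 * π), f (x - u) * (Ψ (u + h) - Ψ u)|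
      ≤ (∫ t in 0..(2 * π), |f t| ^ r) ^ (1 / r)
        * (∫ u in 0..(2 * π), |Ψ (u + h) - Ψ u| ^ q) ^ (1 / q) := by
    rw [← hfnorm]
    refine (intervalIntegral.abs_integral_le_integral_abs hT.le).trans ?_
    simp only [abs_mul, intervalIntegral.integral_of_le hT.le]
    exact integral_mul_norm_le_Lp_mul_Lq hrq hfmem (hDmem _ _ hT.le)
  have hmod : (∫ u in 0..(2 * π), |Ψ (u + h) - Ψ u| ^ q) ^ (1 / q)
      ≤ 2 * (K * A) * B ^ (1 / q) * h ^ (α - 1 / r) := by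
    have hle := integral_abs_sub_rpow_le (by positivity) hq (by linarith) hβq hβq' hΨ hdiff
      hbound' hderiv' hh.1 (by linarith [hh.2]) hDint
    rw [← hB, hexp] at hle
    have hh₀ := hh.1
    calc _ ≤ ((2 * (K * A)) ^ q * B * h ^ ((α - 1 / r) * q)) ^ (1 / q) :=
          rpow_le_rpow (intervalIntegral.integral_nonneg hT.le fun u _ => by positivity) hle
            (by positivity)
      _ = _ := by
        rw [mul_rpow (by positivity) (by positivity), mul_rpow (by positivity) (by positivity),
          ← rpow_mul (by positivity), ← rpow_mul hh₀.le, mul_assoc (α - 1 / r),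
          mul_one_div_cancel hq.ne', mul_one, rpow_one]
  have hF : 0 ≤ (∫ t in 0..(2 * π), |f t| ^ r) ^ (1 / r) :=
    rpow_nonneg (intervalIntegral.integral_nonneg hT.le fun u _ => by positivity) _
  rw [← mul_sub, hdiffeq, abs_mul, abs_of_pos (by positivity : 0 < 1 / (2 * π))]
  calc _ ≤ 1 / (2 * π) * ((∫ t in 0..(2 * π), |f t| ^ r) ^ (1 / r)
        * (2 * (K * A) * B ^ (1 / q) * h ^ (α - 1 / r))) :=
        mul_le_mul_of_nonneg_left
          (hholder.trans (mul_le_mul_of_nonneg_left hmod hF)) (by positivity)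
    _ = _ := by ring
end
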